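/- Let X ∈ ℝ^{n×p} have full column rank and let G ∈ ℝ^{n×p}. Define T₁ := 2·skew(GXᵀ)X. Then: (i) sym(XᵀT₁) = 0, i.e., T₁ is tangent at X; and (ii) for every η ∈ ℝ^{n×p} with sym(Xᵀη) = 0, g_X(T₁, η) = tr(Gᵀη), where g_X(ξ,η) := tr(ξᵀ(I_n − (1/2)X(XᵀX)⁻¹Xᵀ)η(XᵀX)⁻¹). In particular, with G = ∇f(X), T₁(X) = 2·skew(∇f(X)Xᵀ)X is the Riemannian gradient of f on the layered manifold St_{XᵀX}(p,n) with respect to the metric g. -/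

import Mathlib

open Matrix BigOperators

noncomputable section

/-- Symmetric part of a square matrix. -/
def symPart {m : ℕ} (A : Matrix (Fin m) (Fin m) ℝ) : Matrix (Fin m) (Fin m) ℝ :=
  (1 / 2 : ℝ) • (A + Aᵀ)

/-- Skew-symmetric part of a square matrix. -/
def skewPart {m : ℕ} (A : Matrix (Fin m) (Fin m) ℝ) : Matrix (Fin m) (Fin m) ℝ :=
  (1 / 2 : ℝ) • (A - Aᵀ)

/-- The metric `g_X(ξ,η) = tr(ξᵀ(I − (1/2)X(XᵀX)⁻¹Xᵀ)η(XᵀX)⁻¹)` on the ambient space. -/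
def gmet {n p : ℕ} (X ξ η : Matrix (Fin n) (Fin p) ℝ) : ℝ :=
  Matrix.trace (ξᵀ * ((1 : Matrix (Fin n) (Fin n) ℝ)
    - (1 / 2 : ℝ) • (X * (Xᵀ * X)⁻¹ * Xᵀ)) * η * (Xᵀ * X)⁻¹)

/-- The Gram matrix of a real matrix with full column rank is invertible. -/
theorem isUnit_det_transpose_mul_self_of_rank_eq {n p : ℕ} {X : Matrix (Fin n) (Fin p) ℝ}
    (hX : X.rank = p) : IsUnit (Xᵀ * X).det := by
  rw [← Matrix.isUnit_iff_isUnit_det, ← Matrix.mulVec_surjective_iff_isUnit]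
  have hr : (Xᵀ * X).rank = p := (Matrix.rank_transpose_mul_self X).trans hX
  have ht : LinearMap.range (Xᵀ * X).mulVecLin = ⊤ :=
    Submodule.eq_top_of_finrank_eq (by simpa [Matrix.rank] using hr)
  exact LinearMap.range_eq_top.1 ht

theorem symPart_eq_zero_iff {m : ℕ} {A : Matrix (Fin m) (Fin m) ℝ} :
    symPart A = 0 ↔ Aᵀ = -A := by
  rw [symPart, smul_eq_zero_iff_right (by norm_num), add_comm, add_eq_zero_iff_eq_neg]

theorem two_smul_skewPart {m : ℕ} (A : Matrix (Fin m) (Fin m) ℝ) :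
    (2 : ℝ) • skewPart A = A - Aᵀ := by
  simp [skewPart, smul_smul]

/-- If `P` is symmetric and `A` is skew-symmetric then `tr(K P A) = -tr(Kᵀ A P)`. -/
theorem trace_mul_mul_eq_neg_of_symm_of_skew {m : ℕ} (K : Matrix (Fin m) (Fin m) ℝ)
    {P A : Matrix (Fin m) (Fin m) ℝ} (hP : Pᵀ = P) (hA : Aᵀ = -A) :
    (K * P * A).trace = -(Kᵀ * A * P).trace := by
  rw [← Matrix.trace_transpose (K * P * A), Matrix.transpose_mul, Matrix.transpose_mul, hP, hA,
    Matrix.neg_mul, Matrix.trace_neg, ← Matrix.mul_assoc, Matrix.trace_mul_comm, ← Matrix.mul_assoc]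

/-- For full-column-rank `X` and any `G`, `T₁ := 2 skew(GXᵀ)X` is tangent at `X`, and for
every tangent `η`, `g_X(T₁, η) = tr(Gᵀη)`; i.e. with `G = ∇f(X)`, `T₁(X)` is the Riemannian
gradient of `f` on the layered manifold with respect to the metric `g`. -/
theorem T1_is_riemannian_gradient {n p : ℕ}
    (X G : Matrix (Fin n) (Fin p) ℝ) (hX : X.rank = p) :
    symPart (Xᵀ * ((2 : ℝ) • skewPart (G * Xᵀ) * X)) = 0
    ∧ ∀ η : Matrix (Fin n) (Fin p) ℝ, symPart (Xᵀ * η) = 0 →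
        gmet X ((2 : ℝ) • skewPart (G * Xᵀ) * X) η = Matrix.trace (Gᵀ * η) := by
  rw [two_smul_skewPart]
  refine ⟨symPart_eq_zero_iff.2 (by simp [Matrix.mul_assoc, Matrix.sub_mul, Matrix.mul_sub]), ?_⟩
  intro η hη
  have hA : (Xᵀ * η)ᵀ = -(Xᵀ * η) := symPart_eq_zero_iff.1 hη
  have hM := isUnit_det_transpose_mul_self_of_rank_eq hX
  have hP : ((Xᵀ * X)⁻¹)ᵀ = (Xᵀ * X)⁻¹ := by
    simp [Matrix.transpose_nonsing_inv]
  have hK := trace_mul_mul_eq_neg_of_symm_of_skew (Gᵀ * X) hP hA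
  have hMP : Xᵀ * X * (Xᵀ * X)⁻¹ = 1 := Matrix.mul_nonsing_inv _ hM
  have hPM : (Xᵀ * X)⁻¹ * (Xᵀ * X) = 1 := Matrix.nonsing_inv_mul _ hM
  unfold gmet
  generalize (Xᵀ * X)⁻¹ = P at *
  have hcyc (B : Matrix (Fin p) (Fin p) ℝ) : (Xᵀ * X * B * P).trace = B.trace := by
    rw [Matrix.trace_mul_comm, ← Matrix.mul_assoc, hPM, Matrix.one_mul]
  have hexp : ((G * Xᵀ - (G * Xᵀ)ᵀ) * X)ᵀ * (1 - (1 / 2 : ℝ) • (X * P * Xᵀ)) * η * P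
      = Xᵀ * X * (Gᵀ * η) * P - (Gᵀ * X)ᵀ * (Xᵀ * η) * P
        - (1 / 2 : ℝ) • (Xᵀ * X * (Gᵀ * X * P * (Xᵀ * η)) * P
          - (Gᵀ * X)ᵀ * (Xᵀ * X * P) * (Xᵀ * η) * P) := by
    simp only [Matrix.transpose_mul, Matrix.transpose_sub, Matrix.transpose_transpose,
      Matrix.mul_sub, Matrix.sub_mul, Matrix.mul_one, Matrix.mul_smul, Matrix.smul_mul,
      Matrix.mul_assoc, smul_sub]
  rw [hexp, hMP, Matrix.mul_one, Matrix.trace_sub, Matrix.trace_sub, Matrix.trace_smul,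
    Matrix.trace_sub, hcyc, hcyc, hK, smul_eq_mul]
  ring
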